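/- Let L be a finite-dimensional Lie algebra over a field Ω, H a central ideal of L, T = ⟨K(L) ∩ H⟩, and μ : L/H → L a linear section of the projection. Then the quotient (L' ∩ H)/⟨K(L) ∩ H⟩ is isomorphic as an Ω-vector space to the image of the transgression map tra : Hom_T(H,Ω) → B₀(L/H), λ ↦ [λ∘f_μ] where f_μ(x,y) = [μ(x),μ(y)] − μ([x,y]). In particular, if tra is surjective then (L' ∩ H)/⟨K(L) ∩ H⟩ ≅ B₀(L/H). -/

import Mathlib

variable (Ω : Type*) [Field Ω] (L : Type*) [LieRing L] [LieAlgebra Ω L]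

/-- `K(L)`: the set of brackets of a Lie algebra `L`. -/
def bracketSet : Set L := {z | ∃ x y : L, z = ⁅x, y⁆}

/-- `f : L × L → Ω` is a 2-cocycle (with values in the trivial module `Ω`) if it is
bilinear, alternating and satisfies the cocycle identity. -/
def IsTwoCocycle (f : L → L → Ω) : Prop :=
  (∀ x x' y : L, f (x + x') y = f x y + f x' y) ∧
  (∀ x y y' : L, f x (y + y') = f x y + f x y') ∧
  (∀ (a : Ω) (x y : L), f (a • x) y = a * f x y) ∧
  (∀ (a : Ω) (x y : L), f x (a • y) = a * f x y) ∧
  (∀ x : L, f x x = 0) ∧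
  (∀ x y z : L, f ⁅x, y⁆ z + f ⁅y, z⁆ x + f ⁅z, x⁆ y = 0)

/-- `f : L × L → Ω` is a 2-coboundary if `f (x, y) = -σ ⁅x, y⁆` for some linear `σ`. -/
def IsTwoCoboundary (f : L → L → Ω) : Prop :=
  ∃ σ : L →ₗ[Ω] Ω, ∀ x y : L, f x y = -σ ⁅x, y⁆

/-- The subspace of 2-cocycles inside the space of all maps `L → L → Ω`. -/
def twoCocycles : Submodule Ω (L → L → Ω) where
  carrier := {f | IsTwoCocycle Ω L f}
  add_mem' := by
    rintro f g ⟨hf1, hf2, hf3, hf4, hf5, hf6⟩ ⟨hg1, hg2, hg3, hg4, hg5, hg6⟩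
    refine ⟨fun x x' y => ?_, fun x y y' => ?_, fun a x y => ?_, fun a x y => ?_,
      fun x => ?_, fun x y z => ?_⟩ <;>
      simp only [Pi.add_apply]
    · rw [hf1, hg1]; ring
    · rw [hf2, hg2]; ring
    · rw [hf3, hg3]; ring
    · rw [hf4, hg4]; ring
    · rw [hf5, hg5]; ring
    · linear_combination hf6 x y z + hg6 x y z
  zero_mem' := by
    refine ⟨?_, ?_, ?_, ?_, ?_, ?_⟩ <;> simp
  smul_mem' := by
    rintro c f ⟨hf1, hf2, hf3, hf4, hf5, hf6⟩
    refine ⟨fun x x' y => ?_, fun x y y' => ?_, fun a x y => ?_, fun a x y => ?_,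
      fun x => ?_, fun x y z => ?_⟩ <;>
      simp only [Pi.smul_apply, smul_eq_mul]
    · rw [hf1]; ring
    · rw [hf2]; ring
    · rw [hf3]; ring
    · rw [hf4]; ring
    · rw [hf5]; ring
    · linear_combination c * hf6 x y z

/-- The subspace of 2-coboundaries inside the space of all maps `L → L → Ω`. -/
def twoCoboundaries : Submodule Ω (L → L → Ω) where
  carrier := {f | IsTwoCoboundary Ω L f}
  add_mem' := by
    rintro f g ⟨σ, hσ⟩ ⟨τ, hτ⟩
    refine ⟨σ + τ, fun x y => ?_⟩
    simp only [Pi.add_apply, LinearMap.add_apply, hσ x y, hτ x y]; ring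
  zero_mem' := ⟨0, by simp⟩
  smul_mem' := by
    rintro c f ⟨σ, hσ⟩
    refine ⟨c • σ, fun x y => ?_⟩
    simp only [Pi.smul_apply, LinearMap.smul_apply, hσ x y, smul_eq_mul]; ring

/-- The 2-coboundaries viewed as a subspace of the space of 2-cocycles. -/
def twoCoboundariesIn : Submodule Ω (twoCocycles Ω L) :=
  (twoCoboundaries Ω L).comap (twoCocycles Ω L).subtype

/-- The second cohomology `H²(L,Ω)` of `L` with coefficients in the trivial module `Ω`:
2-cocycles modulo 2-coboundaries. -/
abbrev lieH2 := twoCocycles Ω L ⧸ twoCoboundariesIn Ω L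

/-- The cohomology class of a 2-cocycle. -/
def H2class (f : L → L → Ω) (hf : f ∈ twoCocycles Ω L) : lieH2 Ω L :=
  Submodule.Quotient.mk ⟨f, hf⟩

/-- The subspace of maps `L → L → Ω` vanishing on all pairs of commuting elements. -/
def vanishingOnCommuting : Submodule Ω (L → L → Ω) where
  carrier := {f | ∀ x y : L, ⁅x, y⁆ = 0 → f x y = 0}
  add_mem' := by
    intro f g hf hg x y hxy
    simp [Pi.add_apply, hf x y hxy, hg x y hxy]
  zero_mem' := fun x y _ => rfl
  smul_mem' := by
    intro c f hf x y hxy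
    simp [Pi.smul_apply, hf x y hxy]

/-- The Bogomolov multiplier `B₀(L)`: the subspace of `H²(L,Ω)` consisting of the classes
of 2-cocycles `f` such that `f (x, y) = 0` whenever `⁅x, y⁆ = 0`. -/
def B0 : Submodule Ω (lieH2 Ω L) :=
  Submodule.map (twoCoboundariesIn Ω L).mkQ
    ((vanishingOnCommuting Ω L).comap (twoCocycles Ω L).subtype)

section Transgression

/-- The Jacobi identity in the form `⁅⁅a,b⁆,c⁆ + ⁅⁅b,c⁆,a⁆ + ⁅⁅c,a⁆,b⁆ = 0`. -/
theorem lie_lie_jacobi {A : Type*} [LieRing A] (a b c : A) :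
    ⁅⁅a, b⁆, c⁆ + ⁅⁅b, c⁆, a⁆ + ⁅⁅c, a⁆, b⁆ = 0 := by
  have h := lie_jacobi a b c
  have e1 : ⁅⁅a, b⁆, c⁆ = -⁅c, ⁅a, b⁆⁆ := by rw [← lie_skew c ⁅a, b⁆, neg_neg]
  have e2 : ⁅⁅b, c⁆, a⁆ = -⁅a, ⁅b, c⁆⁆ := by rw [← lie_skew a ⁅b, c⁆, neg_neg]
  have e3 : ⁅⁅c, a⁆, b⁆ = -⁅b, ⁅c, a⁆⁆ := by rw [← lie_skew b ⁅c, a⁆, neg_neg]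
  rw [e1, e2, e3, ← neg_add, ← neg_add, neg_eq_zero, add_rotate]
  exact h

variable {Ω : Type*} [Field Ω] {L : Type*} [LieRing L] [LieAlgebra Ω L]

/-- The 2-cocycle `λ ∘ f_μ` on `L/H` obtained from a linear map `λ : H → Ω` and the
factor set `f_μ(x,y) = ⁅μ x, μ y⁆ - μ ⁅x,y⁆` of a linear section `μ` of `L → L/H`. -/
def traCocycle (H : LieIdeal Ω L) (μ : (L ⧸ H) →ₗ[Ω] L)
    (hmem : ∀ x y : L ⧸ H, ⁅μ x, μ y⁆ - μ ⁅x, y⁆ ∈ H) (lam : ↥H →ₗ[Ω] Ω) :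
    (L ⧸ H) → (L ⧸ H) → Ω :=
  fun x y => lam ⟨⁅μ x, μ y⁆ - μ ⁅x, y⁆, hmem x y⟩

/-- For a central ideal `H`, `λ ∘ f_μ` is a 2-cocycle on `L/H`. -/
theorem traCocycle_mem_twoCocycles (H : LieIdeal Ω L) (hH : H ≤ LieAlgebra.center Ω L)
    (μ : (L ⧸ H) →ₗ[Ω] L)
    (hμ : ∀ x : L ⧸ H, LieSubmodule.Quotient.mk (N := H) (μ x) = x)
    (hmem : ∀ x y : L ⧸ H, ⁅μ x, μ y⁆ - μ ⁅x, y⁆ ∈ H) (lam : ↥H →ₗ[Ω] Ω) :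
    traCocycle H μ hmem lam ∈ twoCocycles Ω (L ⧸ H) := by
  have hcent : ∀ a : L, a ∈ H → ∀ b : L, ⁅a, b⁆ = 0 := by
    intro a ha b
    have h := (LieModule.mem_maxTrivSubmodule Ω L L a).mp (hH ha) b
    rw [← lie_skew, h, neg_zero]
  refine ⟨?_, ?_, ?_, ?_, ?_, ?_⟩
  · intro x x' y
    have e : (⟨⁅μ (x + x'), μ y⁆ - μ ⁅x + x', y⁆, hmem _ _⟩ : ↥H)
        = ⟨⁅μ x, μ y⁆ - μ ⁅x, y⁆, hmem _ _⟩ + ⟨⁅μ x', μ y⁆ - μ ⁅x', y⁆, hmem _ _⟩ :=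
      Subtype.ext (by simp only [LieSubmodule.coe_add, map_add, add_lie]; abel)
    show lam _ = lam _ + lam _
    rw [e, map_add]
  · intro x y y'
    have e : (⟨⁅μ x, μ (y + y')⁆ - μ ⁅x, y + y'⁆, hmem _ _⟩ : ↥H)
        = ⟨⁅μ x, μ y⁆ - μ ⁅x, y⁆, hmem _ _⟩ + ⟨⁅μ x, μ y'⁆ - μ ⁅x, y'⁆, hmem _ _⟩ :=
      Subtype.ext (by simp only [LieSubmodule.coe_add, map_add, lie_add]; abel)
    show lam _ = lam _ + lam _
    rw [e, map_add]
  · intro a x y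
    have e : (⟨⁅μ (a • x), μ y⁆ - μ ⁅a • x, y⁆, hmem _ _⟩ : ↥H)
        = a • ⟨⁅μ x, μ y⁆ - μ ⁅x, y⁆, hmem _ _⟩ :=
      Subtype.ext (by simp only [SetLike.val_smul, map_smul, smul_lie, smul_sub])
    show lam _ = _ * lam _
    rw [e, map_smul, smul_eq_mul]
  · intro a x y
    have e : (⟨⁅μ x, μ (a • y)⁆ - μ ⁅x, a • y⁆, hmem _ _⟩ : ↥H)
        = a • ⟨⁅μ x, μ y⁆ - μ ⁅x, y⁆, hmem _ _⟩ :=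
      Subtype.ext (by simp only [SetLike.val_smul, map_smul, lie_smul, smul_sub])
    show lam _ = _ * lam _
    rw [e, map_smul, smul_eq_mul]
  · intro x
    have e : (⟨⁅μ x, μ x⁆ - μ ⁅x, x⁆, hmem _ _⟩ : ↥H) = 0 := Subtype.ext (by simp)
    show lam _ = 0
    rw [e, map_zero]
  · intro x y z
    have key : ∀ u v : L ⧸ H, ∀ c : L, ⁅μ ⁅u, v⁆, c⁆ = ⁅⁅μ u, μ v⁆, c⁆ := by
      intro u v c
      have h1 : ⁅⁅μ u, μ v⁆ - μ ⁅u, v⁆, c⁆ = 0 := hcent _ (hmem u v) c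
      rw [sub_lie, sub_eq_zero] at h1
      exact h1.symm
    have jac : ⁅⁅x, y⁆, z⁆ + ⁅⁅y, z⁆, x⁆ + ⁅⁅z, x⁆, y⁆ = (0 : L ⧸ H) :=
      lie_lie_jacobi x y z
    have e : (⟨⁅μ ⁅x, y⁆, μ z⁆ - μ ⁅⁅x, y⁆, z⁆, hmem _ _⟩ : ↥H)
        + ⟨⁅μ ⁅y, z⁆, μ x⁆ - μ ⁅⁅y, z⁆, x⁆, hmem _ _⟩
        + ⟨⁅μ ⁅z, x⁆, μ y⁆ - μ ⁅⁅z, x⁆, y⁆, hmem _ _⟩ = 0 := by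
      apply Subtype.ext
      simp only [LieSubmodule.coe_add, LieSubmodule.coe_zero]
      rw [key x y (μ z), key y z (μ x), key z x (μ y)]
      have h2 : μ ⁅⁅x, y⁆, z⁆ + μ ⁅⁅y, z⁆, x⁆ + μ ⁅⁅z, x⁆, y⁆ = 0 := by
        rw [← map_add, ← map_add, jac, map_zero]
      have h1 : ⁅⁅μ x, μ y⁆, μ z⁆ + ⁅⁅μ y, μ z⁆, μ x⁆ + ⁅⁅μ z, μ x⁆, μ y⁆ = (0 : L) :=
        lie_lie_jacobi _ _ _
      have comb : (⁅⁅μ x, μ y⁆, μ z⁆ - μ ⁅⁅x, y⁆, z⁆) + (⁅⁅μ y, μ z⁆, μ x⁆ - μ ⁅⁅y, z⁆, x⁆)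
          + (⁅⁅μ z, μ x⁆, μ y⁆ - μ ⁅⁅z, x⁆, y⁆)
          = (⁅⁅μ x, μ y⁆, μ z⁆ + ⁅⁅μ y, μ z⁆, μ x⁆ + ⁅⁅μ z, μ x⁆, μ y⁆)
            - (μ ⁅⁅x, y⁆, z⁆ + μ ⁅⁅y, z⁆, x⁆ + μ ⁅⁅z, x⁆, y⁆) := by abel
      rw [comb, h1, h2, sub_zero]
    show lam _ + lam _ + lam _ = 0
    rw [← map_add, ← map_add, e, map_zero]

/-- If moreover `λ` vanishes on `T = ⟨K(L) ∩ H⟩`, the class of `λ ∘ f_μ` lies in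
`B₀(L/H)`; this is the transgression map `tra : Hom_T(H,Ω) → B₀(L/H)`. -/
theorem traCocycle_class_mem_B0 (H : LieIdeal Ω L) (hH : H ≤ LieAlgebra.center Ω L)
    (μ : (L ⧸ H) →ₗ[Ω] L)
    (hμ : ∀ x : L ⧸ H, LieSubmodule.Quotient.mk (N := H) (μ x) = x)
    (hmem : ∀ x y : L ⧸ H, ⁅μ x, μ y⁆ - μ ⁅x, y⁆ ∈ H) (lam : ↥H →ₗ[Ω] Ω)
    (hlam : ∀ h : ↥H, (h : L) ∈ Submodule.span Ω (bracketSet L ∩ (H : Set L)) → lam h = 0) :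
    H2class Ω (L ⧸ H) (traCocycle H μ hmem lam)
      (traCocycle_mem_twoCocycles H hH μ hμ hmem lam) ∈ B0 Ω (L ⧸ H) := by
  refine ⟨⟨traCocycle H μ hmem lam, traCocycle_mem_twoCocycles H hH μ hμ hmem lam⟩, ?_, rfl⟩
  show traCocycle H μ hmem lam ∈ vanishingOnCommuting Ω (L ⧸ H)
  intro x y hxy
  have hb : ⁅μ x, μ y⁆ ∈ H := by
    have h := hmem x y
    rwa [hxy, map_zero, sub_zero] at h
  apply hlam
  show ⁅μ x, μ y⁆ - μ ⁅x, y⁆ ∈ _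
  rw [hxy, map_zero, sub_zero]
  exact Submodule.subset_span ⟨⟨μ x, μ y, rfl⟩, hb⟩

end Transgression

section Helpers

variable {Ω : Type*} [Field Ω] {L : Type*} [LieRing L] [LieAlgebra Ω L]

/-- The linear functionals on `H` vanishing on `T`. -/
def homT (H : LieIdeal Ω L) : Submodule Ω (↥H →ₗ[Ω] Ω) where
  carrier := {lam | ∀ h : ↥H, (h : L) ∈ Submodule.span Ω (bracketSet L ∩ (H : Set L)) → lam h = 0}
  add_mem' := by
    intro f g hf hg h hh
    simp [hf h hh, hg h hh]
  zero_mem' := fun h _ => rfl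
  smul_mem' := by
    intro c f hf h hh
    simp [hf h hh]

/-- The transgression as a linear map. -/
def traLin (H : LieIdeal Ω L) (hH : H ≤ LieAlgebra.center Ω L)
    (μ : (L ⧸ H) →ₗ[Ω] L)
    (hμ : ∀ x : L ⧸ H, LieSubmodule.Quotient.mk (N := H) (μ x) = x)
    (hmem : ∀ x y : L ⧸ H, ⁅μ x, μ y⁆ - μ ⁅x, y⁆ ∈ H) :
    homT H →ₗ[Ω] ↥(B0 Ω (L ⧸ H)) where
  toFun lam := ⟨H2class Ω (L ⧸ H) (traCocycle H μ hmem lam.1)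
              (traCocycle_mem_twoCocycles H hH μ hμ hmem lam.1),
            traCocycle_class_mem_B0 H hH μ hμ hmem lam.1 lam.2⟩
  map_add' _ _ := rfl
  map_smul' _ _ := rfl

theorem traLin_eq_zero_iff (H : LieIdeal Ω L) (hH : H ≤ LieAlgebra.center Ω L)
    (μ : (L ⧸ H) →ₗ[Ω] L)
    (hμ : ∀ x : L ⧸ H, LieSubmodule.Quotient.mk (N := H) (μ x) = x)
    (hmem : ∀ x y : L ⧸ H, ⁅μ x, μ y⁆ - μ ⁅x, y⁆ ∈ H) (lam : homT H) :
    traLin H hH μ hμ hmem lam = 0 ↔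
      ∀ h : ↥H, (h : L) ∈ Submodule.span Ω (bracketSet L) → lam.1 h = 0 := by
  have h0 : traLin H hH μ hμ hmem lam = 0 ↔
      IsTwoCoboundary Ω (L ⧸ H) (traCocycle H μ hmem lam.1) := by
    rw [Subtype.ext_iff]
    exact Submodule.Quotient.mk_eq_zero _
  rw [h0]
  have hcent : ∀ a : L, a ∈ H → ∀ b : L, ⁅b, a⁆ = 0 := by
    intro a ha b
    exact (LieModule.mem_maxTrivSubmodule Ω L L a).mp (hH ha) b
  have hcent' : ∀ a : L, a ∈ H → ∀ b : L, ⁅a, b⁆ = 0 := by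
    intro a ha b
    rw [← lie_skew, hcent a ha, neg_zero]
  constructor
  · rintro ⟨σ, hσ⟩
    let π : L →ₗ[Ω] (L ⧸ H) := (LieSubmodule.Quotient.mk' H : L →ₗ[Ω] (L ⧸ H))
    have hπ : ∀ a, π a = LieSubmodule.Quotient.mk (N := H) a := fun _ => rfl
    have hsub : ∀ a : L, a - μ (π a) ∈ H := by
      intro a
      have h1 : π (a - μ (π a)) = 0 := by rw [map_sub, hπ (μ _), hμ, sub_self]
      exact (LieSubmodule.Quotient.mk_eq_zero H).1 h1
    have hπ0 : ∀ a ∈ H, π a = 0 := fun a ha =>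
      (LieSubmodule.Quotient.mk_eq_zero H).2 ha
    let δ : L →ₗ[Ω] (H : Submodule Ω L) :=
      LinearMap.codRestrict (H : Submodule Ω L) (LinearMap.id - μ ∘ₗ π) (fun a => hsub a)
    let Λ : L →ₗ[Ω] Ω := (lam.1 : (H : Submodule Ω L) →ₗ[Ω] Ω) ∘ₗ δ + σ ∘ₗ π
    have hΛ : ∀ z ∈ Submodule.span Ω (bracketSet L), Λ z = 0 := by
      intro z hz
      induction hz using Submodule.span_induction with
      | mem z hz =>
        obtain ⟨a, b, rfl⟩ := hz
        have e : ⁅a, b⁆ = ⁅μ (π a), μ (π b)⁆ := by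
          have e1 := hcent' _ (hsub a) b
          have e2 := hcent _ (hsub b) (μ (π a))
          rw [sub_lie, sub_eq_zero] at e1
          rw [lie_sub, sub_eq_zero] at e2
          rw [e1, e2]
        have eπ : π ⁅a, b⁆ = ⁅π a, π b⁆ := rfl
        have h1 := hσ (π a) (π b)
        have h2 : δ ⁅a, b⁆ = ⟨⁅μ (π a), μ (π b)⁆ - μ ⁅π a, π b⁆, hmem _ _⟩ := by
          apply Subtype.ext
          change ⁅a, b⁆ - μ (π ⁅a, b⁆) = _
          rw [eπ, e]
        change lam.1 (δ ⁅a, b⁆) + σ (π ⁅a, b⁆) = 0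
        rw [h2, eπ]
        change traCocycle H μ hmem lam.1 (π a) (π b) + _ = 0
        rw [h1]; ring
      | zero => simp
      | add x y _ _ hx hy => rw [map_add, hx, hy, add_zero]
      | smul c x _ hx => rw [map_smul, hx, smul_zero]
    intro h hh
    have h1 := hΛ _ hh
    have h2 : δ (h : L) = h := by
      apply Subtype.ext
      change (h : L) - μ (π h) = h
      rw [hπ0 _ h.2, map_zero, sub_zero]
    change lam.1 (δ (h : L)) + σ (π h) = 0 at h1
    rw [h2, hπ0 _ h.2, map_zero, add_zero] at h1
    exact h1
  · intro hl
    let D := Submodule.span Ω (bracketSet L)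
    let g : (H : Submodule Ω L) →ₗ[Ω] (L ⧸ D) := D.mkQ ∘ₗ (H : Submodule Ω L).subtype
    have hr : (lam.1 : (H : Submodule Ω L) →ₗ[Ω] Ω) ∈ LinearMap.range g.dualMap := by
      rw [LinearMap.range_dualMap_eq_dualAnnihilator_ker]
      refine (Submodule.mem_dualAnnihilator _).2 ?_
      intro h hh
      apply hl
      exact (Submodule.Quotient.mk_eq_zero D).1 hh
    obtain ⟨φ, hφ⟩ := hr
    refine ⟨(φ ∘ₗ D.mkQ) ∘ₗ μ, fun x y => ?_⟩
    have h1 : traCocycle H μ hmem lam.1 x y = φ (D.mkQ (⁅μ x, μ y⁆ - μ ⁅x, y⁆)) :=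
      (LinearMap.congr_fun hφ ⟨⁅μ x, μ y⁆ - μ ⁅x, y⁆, hmem x y⟩).symm
    have h2 : D.mkQ ⁅μ x, μ y⁆ = 0 :=
      (Submodule.Quotient.mk_eq_zero D).2 (Submodule.subset_span ⟨_, _, rfl⟩)
    rw [h1, map_sub, h2, zero_sub, map_neg]
    rfl

/-- The space `L' ∩ H`. -/
abbrev derH (H : LieIdeal Ω L) : Submodule Ω L :=
  Submodule.span Ω (bracketSet L) ⊓ (H : Submodule Ω L)

/-- `T` as a subspace of `L' ∩ H`. -/
abbrev derT (H : LieIdeal Ω L) : Submodule Ω (derH H) :=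
  (Submodule.span Ω (bracketSet L ∩ (H : Set L))).comap (derH H).subtype

/-- The inclusion of `L' ∩ H` in `H`. -/
def derIncl (H : LieIdeal Ω L) : derH H →ₗ[Ω] (H : Submodule Ω L) :=
  Submodule.inclusion inf_le_right

/-- Restriction of functionals. -/
def resLin (H : LieIdeal Ω L) : homT H →ₗ[Ω] ((derH H ⧸ derT H) →ₗ[Ω] Ω) where
  toFun lam := (derT H).liftQ ((lam.1 : (H : Submodule Ω L) →ₗ[Ω] Ω) ∘ₗ derIncl H)
    (fun d hd => lam.2 (derIncl H d) hd)
  map_add' _ _ := by ext; rfl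
  map_smul' _ _ := by ext; rfl

theorem resLin_surjective (H : LieIdeal Ω L) : Function.Surjective (resLin H) := by
  intro φ
  have hs : Function.Surjective (derIncl H).dualMap :=
    LinearMap.dualMap_surjective_of_injective (Submodule.inclusion_injective _)
  obtain ⟨lam, hlam⟩ := hs (φ ∘ₗ (derT H).mkQ)
  refine ⟨⟨lam, fun h hh => ?_⟩, ?_⟩
  · have hD : (h : L) ∈ derH H :=
      ⟨Submodule.span_mono Set.inter_subset_left hh, h.2⟩
    have h1 := LinearMap.congr_fun hlam ⟨(h : L), hD⟩
    have h2 : (derT H).mkQ ⟨(h : L), hD⟩ = 0 := (Submodule.Quotient.mk_eq_zero _).2 hh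
    have h3 : lam h = φ ((derT H).mkQ ⟨(h : L), hD⟩) := h1
    exact h3.trans (by rw [h2, map_zero])
  · apply Submodule.linearMap_qext
    ext d
    exact LinearMap.congr_fun hlam d

theorem resLin_eq_zero_iff (H : LieIdeal Ω L) (lam : homT H) : resLin H lam = 0 ↔
      ∀ h : ↥H, (h : L) ∈ Submodule.span Ω (bracketSet L) → lam.1 h = 0 := by
  constructor
  · intro h0 h hh
    exact LinearMap.congr_fun h0 ((derT H).mkQ ⟨(h : L), hh, h.2⟩)
  · intro h0
    apply Submodule.linearMap_qext
    ext d
    exact h0 (derIncl H d) d.2.1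

theorem exists_factor {P A B : Type*} [AddCommMonoid P] [Module Ω P] [AddCommGroup A] [Module Ω A]
    [AddCommGroup B] [Module Ω B] (f : P →ₗ[Ω] A) (g : P →ₗ[Ω] B) (hf : Function.Surjective f)
    (hk : ∀ p, f p = 0 ↔ g p = 0) :
    ∃ e : A →ₗ[Ω] B, Function.Injective e ∧ Set.range e = Set.range g := by
  have hk' : ∀ p q, f p = f q ↔ g p = g q := by
    intro p q
    have h := hk (p + (-1 : Ω) • q)
    simp only [map_add, map_smul, neg_smul, one_smul, ← sub_eq_add_neg, sub_eq_zero] at h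
    exact h
  have hs := Function.surjInv_eq hf
  have hg : ∀ p, g (Function.surjInv hf (f p)) = g p := fun p => (hk' _ _).1 (hs _)
  refine ⟨{ toFun := fun a => g (Function.surjInv hf a), map_add' := ?_, map_smul' := ?_ }, ?_, ?_⟩
  · intro a b
    rw [← map_add, ← hk', map_add, hs, hs, hs]
  · intro c a
    rw [RingHom.id_apply, ← map_smul, ← hk', map_smul, hs, hs]
  · intro a b hab
    have h := (hk' _ _).2 hab
    rwa [hs, hs] at h
  · ext b
    constructor
    · rintro ⟨a, rfl⟩
      exact ⟨_, rfl⟩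
    · rintro ⟨p, rfl⟩
      exact ⟨f p, hg p⟩

end Helpers

/-- Let `H` be a central ideal of a finite-dimensional Lie algebra `L`,
`T = ⟨K(L) ∩ H⟩`, and `μ` a linear section of `L → L/H`.  Then
`(L' ∩ H)/⟨K(L) ∩ H⟩` is isomorphic, as an `Ω`-vector space, to the image of the
transgression map `tra : Hom_T(H,Ω) → B₀(L/H)`, `λ ↦ [λ ∘ f_μ]`.  In particular, if
`tra` is surjective, then `(L' ∩ H)/⟨K(L) ∩ H⟩ ≅ B₀(L/H)`. -/
theorem derived_inter_quotient_iso_image_transgression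
    (Ω : Type*) [Field Ω] (L : Type*) [LieRing L] [LieAlgebra Ω L] [FiniteDimensional Ω L]
    (H : LieIdeal Ω L) (hH : H ≤ LieAlgebra.center Ω L)
    (μ : (L ⧸ H) →ₗ[Ω] L)
    (hμ : ∀ x : L ⧸ H, LieSubmodule.Quotient.mk (N := H) (μ x) = x)
    (hmem : ∀ x y : L ⧸ H, ⁅μ x, μ y⁆ - μ ⁅x, y⁆ ∈ H) :
    (∃ e : (↥(Submodule.span Ω (bracketSet L) ⊓ (H : Submodule Ω L)) ⧸
        (Submodule.span Ω (bracketSet L ∩ (H : Set L))).comap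
          (Submodule.span Ω (bracketSet L) ⊓ (H : Submodule Ω L)).subtype) →ₗ[Ω]
        ↥(B0 Ω (L ⧸ H)),
      Function.Injective e ∧
      Set.range e = Set.range
        (fun lam : {lam : ↥H →ₗ[Ω] Ω //
            ∀ h : ↥H, (h : L) ∈ Submodule.span Ω (bracketSet L ∩ (H : Set L)) → lam h = 0} =>
          (⟨H2class Ω (L ⧸ H) (traCocycle H μ hmem lam.1)
              (traCocycle_mem_twoCocycles H hH μ hμ hmem lam.1),
            traCocycle_class_mem_B0 H hH μ hμ hmem lam.1 lam.2⟩ : ↥(B0 Ω (L ⧸ H))))) ∧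
    (Function.Surjective
        (fun lam : {lam : ↥H →ₗ[Ω] Ω //
            ∀ h : ↥H, (h : L) ∈ Submodule.span Ω (bracketSet L ∩ (H : Set L)) → lam h = 0} =>
          (⟨H2class Ω (L ⧸ H) (traCocycle H μ hmem lam.1)
              (traCocycle_mem_twoCocycles H hH μ hμ hmem lam.1),
            traCocycle_class_mem_B0 H hH μ hμ hmem lam.1 lam.2⟩ : ↥(B0 Ω (L ⧸ H)))) →
      Nonempty ((↥(Submodule.span Ω (bracketSet L) ⊓ (H : Submodule Ω L)) ⧸
        (Submodule.span Ω (bracketSet L ∩ (H : Set L))).comap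
          (Submodule.span Ω (bracketSet L) ⊓ (H : Submodule Ω L)).subtype) ≃ₗ[Ω]
        ↥(B0 Ω (L ⧸ H)))) := by
  have hker : ∀ lam, resLin H lam = 0 ↔ traLin H hH μ hμ hmem lam = 0 := by
    intro lam
    rw [resLin_eq_zero_iff, traLin_eq_zero_iff]
  let e1 : (derH H ⧸ derT H) ≃ₗ[Ω] ((derH H ⧸ derT H) →ₗ[Ω] Ω) :=
    LinearEquiv.ofFinrankEq _ _ Subspace.dual_finrank_eq.symm
  obtain ⟨e, he, hr⟩ := exists_factor (resLin H) (traLin H hH μ hμ hmem) (resLin_surjective H) hker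
  have hi : Function.Injective (e ∘ₗ e1.toLinearMap) := he.comp e1.injective
  have hrange : Set.range (e ∘ₗ e1.toLinearMap) = Set.range (traLin H hH μ hμ hmem) := by
    rw [← hr]
    exact e1.surjective.range_comp e
  refine ⟨⟨e ∘ₗ e1.toLinearMap, hi, hrange⟩, fun hs => ?_⟩
  have hs' : Set.range (traLin H hH μ hμ hmem) = Set.univ := Set.range_eq_univ.2 hs
  exact ⟨LinearEquiv.ofBijective (e ∘ₗ e1.toLinearMap)
    ⟨hi, Set.range_eq_univ.1 (hrange.trans hs')⟩⟩
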